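/- arXiv:1112.6262 — 5 statements merged into one kernel-verified Lean document; each statement's English description precedes it below -/
import Mathlib

section
/- For every integer n ≠ 0, the n-th Fourier coefficient of the periodized logarithm satisfies (1/(2π)) ∫_0^{2π} log(4 sin²(s/2)) e^{−i n s} ds = −1/|n|. -/
open Complex in
/-- The factor `e^{-is} - 1` in half-angle form. -/
theorem exp_neg_I_mul_sub_one (s : ℝ) :
    exp (-I * s) - 1 = -I * exp (-I * (s / 2)) * ((2 * Real.sin (s / 2) : ℝ) : ℂ) := by
  have h : exp (-I * s) = exp (-I * (s / 2)) * exp (-I * (s / 2)) := by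
    rw [← exp_add]; ring_nf
  have h' : exp (-I * (s / 2)) * exp ((s / 2 : ℂ) * I) = 1 := by
    rw [← exp_add]; ring_nf; simp
  push_cast
  rw [h, Complex.sin, show -(s / 2 : ℂ) * I = -I * (s / 2) by ring]
  linear_combination h' + exp (-I * (s / 2)) *
    (exp (-I * (s / 2)) - exp ((s / 2 : ℂ) * I)) * I_sq

open Complex in
/-- The product of `e^{-is} - 1` with the periodized logarithm is continuous, including at the
singularities of the logarithm. -/
theorem continuous_exp_sub_one_mul_log_sin_sq :
    Continuous fun s : ℝ ↦ (exp (-I * s) - 1) * (Real.log (4 * Real.sin (s / 2) ^ 2) : ℂ) := by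
  have h (s : ℝ) : (exp (-I * s) - 1) * (Real.log (4 * Real.sin (s / 2) ^ 2) : ℂ) =
      -2 * I * exp (-I * (s / 2)) *
        ((2 * Real.sin (s / 2) * Real.log (2 * Real.sin (s / 2)) : ℝ) : ℂ) := by
    rw [exp_neg_I_mul_sub_one, show 4 * Real.sin (s / 2) ^ 2 = (2 * Real.sin (s / 2)) ^ 2 by ring,
      Real.log_pow]
    push_cast
    ring
  simp_rw [h]
  have hc : Continuous fun s : ℝ ↦ 2 * Real.sin (s / 2) * Real.log (2 * Real.sin (s / 2)) :=
    Real.continuous_mul_log.comp (g := fun x ↦ x * Real.log x)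
      (f := fun s : ℝ ↦ 2 * Real.sin (s / 2)) (by fun_prop)
  fun_prop

/-- The periodized logarithm is interval integrable. -/
theorem intervalIntegrable_log_four_mul_sin_sq (a b : ℝ) :
    IntervalIntegrable (fun s ↦ Real.log (4 * Real.sin (s / 2) ^ 2)) MeasureTheory.volume a b := by
  refine MeromorphicOn.intervalIntegrable_log (f := fun s ↦ 4 * Real.sin (s / 2) ^ 2)
    (AnalyticOnNhd.meromorphicOn fun x _ ↦ ?_)
  fun_prop

/-- The derivative of the periodized logarithm away from its singularities. -/
theorem hasDerivAt_log_four_mul_sin_sq {s : ℝ} (hs : Real.sin (s / 2) ≠ 0) :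
    HasDerivAt (fun s ↦ Real.log (4 * Real.sin (s / 2) ^ 2))
      (Real.cos (s / 2) / Real.sin (s / 2)) s := by
  have h := ((((hasDerivAt_id s).div_const 2).sin.pow 2).const_mul 4).log
    (by simpa using hs)
  convert! h using 1
  simp only [id, Pi.pow_apply]
  field_simp
  norm_num [mul_comm]

open Complex in
/-- The integral of `e^{-iks}` over a period. -/
theorem integral_exp_neg_I_mul_pow (k : ℕ) :
    ∫ s in (0 : ℝ)..(2 * Real.pi), exp (-I * s) ^ k = if k = 0 then (2 * Real.pi : ℂ) else 0 := by
  split_ifs with hk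
  · simp [hk]
  · have hk' : (-I * k : ℂ) ≠ 0 := by simp [hk]
    have h (s : ℝ) : exp (-I * s) ^ k = exp (-I * k * s) := by
      rw [← exp_nat_mul]; ring_nf
    simp_rw [h]
    rw [integral_exp_mul_complex hk']
    have : exp (-I * k * (2 * Real.pi : ℝ)) = 1 :=
      exp_eq_one_iff.mpr ⟨-k, by push_cast; ring⟩
    rw [this]
    simp

open Complex in
/-- The integral over a period of the conjugate Dirichlet-type kernel `(1 + w) ∑_{k < n} w^k`,
`w = e^{-is}`. -/
theorem integral_one_add_mul_geom_sum {n : ℕ} (hn : n ≠ 0) :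
    ∫ s in (0 : ℝ)..(2 * Real.pi),
      (1 + exp (-I * s)) * ∑ k ∈ Finset.range n, exp (-I * s) ^ k = 2 * Real.pi := by
  have h (s : ℝ) : (1 + exp (-I * s)) * ∑ k ∈ Finset.range n, exp (-I * s) ^ k =
      ∑ k ∈ Finset.range n, (exp (-I * s) ^ k + exp (-I * s) ^ (k + 1)) := by
    rw [Finset.mul_sum]
    exact Finset.sum_congr rfl fun k _ ↦ by ring
  have hi (k : ℕ) : IntervalIntegrable (fun s : ℝ ↦ exp (-I * s) ^ k) MeasureTheory.volume
      0 (2 * Real.pi) := Continuous.intervalIntegrable (by fun_prop) _ _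
  simp_rw [h]
  rw [intervalIntegral.integral_finsetSum fun k _ ↦ (hi k).add (hi (k + 1))]
  simp_rw [intervalIntegral.integral_add (hi _) (hi _), integral_exp_neg_I_mul_pow]
  simp [Finset.sum_ite_eq', Nat.pos_of_ne_zero hn]

open Complex in
/-- The Fourier integral of the periodized logarithm at a positive frequency. -/
theorem integral_log_four_mul_sin_sq_mul_exp_pow {n : ℕ} (hn : n ≠ 0) :
    ∫ s in (0 : ℝ)..(2 * Real.pi),
      (Real.log (4 * Real.sin (s / 2) ^ 2) : ℂ) * exp (-I * s) ^ n = -(2 * Real.pi) / n := by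
  have hn' : (n : ℂ) ≠ 0 := Nat.cast_ne_zero.mpr hn
  have hcont : Continuous fun s : ℝ ↦
      (Real.log (4 * Real.sin (s / 2) ^ 2) : ℂ) * ((exp (-I * s) ^ n - 1) * (I / n)) := by
    have h (s : ℝ) :
        (Real.log (4 * Real.sin (s / 2) ^ 2) : ℂ) * ((exp (-I * s) ^ n - 1) * (I / n)) =
        ((exp (-I * s) - 1) * (Real.log (4 * Real.sin (s / 2) ^ 2) : ℂ)) *
          ((∑ k ∈ Finset.range n, exp (-I * s) ^ k) * (I / n)) := by
      rw [← geom_sum_mul]; ring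
    simp_rw [h]
    exact continuous_exp_sub_one_mul_log_sin_sq.mul (by fun_prop)
  have hderiv : ∀ s ∈ Set.Ioo 0 (2 * Real.pi), HasDerivAt (fun s : ℝ ↦
      (Real.log (4 * Real.sin (s / 2) ^ 2) : ℂ) * ((exp (-I * s) ^ n - 1) * (I / n)))
      ((Real.log (4 * Real.sin (s / 2) ^ 2) : ℂ) * exp (-I * s) ^ n +
        1 / n * ((1 + exp (-I * s)) * ∑ k ∈ Finset.range n, exp (-I * s) ^ k)) s := by
    intro s hs
    have hsin : Real.sin (s / 2) ≠ 0 :=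
      (Real.sin_pos_of_pos_of_lt_pi (by linarith [hs.1]) (by linarith [hs.2])).ne'
    have hexp : HasDerivAt (fun s : ℝ ↦ (exp (-I * s) ^ n - 1) * (I / n))
        (exp (-I * s) ^ n) s := by
      have h := (((((hasDerivAt_id s).ofReal_comp.const_mul (-I)).cexp.pow n).sub_const 1).mul_const
        (I / n))
      convert! h using 1
      simp only [id]
      obtain ⟨m, rfl⟩ := Nat.exists_eq_succ_of_ne_zero hn
      simp only [Nat.succ_eq_add_one, Nat.add_sub_cancel, pow_succ] at hn' ⊢
      field_simp
      simp
    convert! (hasDerivAt_log_four_mul_sin_sq hsin).ofReal_comp.mul hexp using 1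
    rw [← geom_sum_mul, exp_neg_I_mul_sub_one s]
    have hw : 1 + exp (-I * s) = 2 * exp (-I * (s / 2)) * Complex.cos (s / 2) := by
      rw [Complex.cos, show -(s / 2 : ℂ) * I = -I * (s / 2) by ring,
        show exp (-I * s) = exp (-I * (s / 2)) * exp (-I * (s / 2)) by
          rw [← exp_add]; ring_nf]
      have h' : exp (-I * (s / 2)) * exp ((s / 2 : ℂ) * I) = 1 := by
        rw [← exp_add]; ring_nf; simp
      linear_combination -h'
    have hsin' : Complex.sin (s / 2) ≠ 0 := by exact_mod_cast hsin
    rw [hw]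
    push_cast
    generalize ∑ k ∈ Finset.range n, exp (-I * s) ^ k = S
    field_simp
    linear_combination (2 * exp (-(I * s / 2)) * Complex.cos (s / 2) * S) * I_sq
  have hL : IntervalIntegrable (fun s : ℝ ↦
      (Real.log (4 * Real.sin (s / 2) ^ 2) : ℂ) * exp (-I * s) ^ n) MeasureTheory.volume
      0 (2 * Real.pi) :=
    IntervalIntegrable.mul_continuousOn
      ⟨(intervalIntegrable_log_four_mul_sin_sq _ _).1.ofReal,
        (intervalIntegrable_log_four_mul_sin_sq _ _).2.ofReal⟩
      (Continuous.continuousOn (by fun_prop))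
  have hK : IntervalIntegrable (fun s : ℝ ↦
      1 / (n : ℂ) * ((1 + exp (-I * s)) * ∑ k ∈ Finset.range n, exp (-I * s) ^ k))
      MeasureTheory.volume 0 (2 * Real.pi) := Continuous.intervalIntegrable (by fun_prop) _ _
  have h := intervalIntegral.integral_eq_sub_of_hasDerivAt_of_le (by positivity)
    hcont.continuousOn hderiv (hL.add hK)
  rw [intervalIntegral.integral_add hL hK, intervalIntegral.integral_const_mul,
    integral_one_add_mul_geom_sum hn] at h
  simp only [mul_zero, ofReal_zero, ofReal_mul, ofReal_ofNat, zero_div, Real.sin_zero, ne_eq,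
    OfNat.ofNat_ne_zero, not_false_eq_true, zero_pow, Real.log_zero, zero_mul, sub_zero,
    mul_div_cancel_left₀, Real.sin_pi] at h
  linear_combination h

/-- For every integer `n ≠ 0`, the `n`-th Fourier coefficient of the periodized
logarithm satisfies `(1/(2π)) ∫_0^{2π} log(4 sin²(s/2)) e^{−i n s} ds = −1/|n|`. -/
theorem fourier_coeff_periodized_log (n : ℤ) (hn : n ≠ 0) :
    (1 / (2 * Real.pi) : ℂ) *
        ∫ s in (0:ℝ)..(2 * Real.pi),
          (Real.log (4 * Real.sin (s / 2) ^ 2) : ℂ) *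
            Complex.exp (-Complex.I * (n : ℂ) * (s : ℂ))
      = -1 / ((|n| : ℤ) : ℂ) := by
  have hpi : (Real.pi : ℂ) ≠ 0 := Complex.ofReal_ne_zero.mpr Real.pi_ne_zero
  obtain ⟨m, rfl | rfl⟩ := n.eq_nat_or_neg
  · have hm : m ≠ 0 := by simpa using hn
    have h (s : ℝ) : Complex.exp (-Complex.I * ((m : ℤ) : ℂ) * s) =
        Complex.exp (-Complex.I * s) ^ m := by
      rw [← Complex.exp_nat_mul]; push_cast; ring_nf
    simp_rw [h]
    rw [integral_log_four_mul_sin_sq_mul_exp_pow hm]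
    simp
    field_simp
  · have hm : m ≠ 0 := by simpa using hn
    have h (s : ℝ) : (Real.log (4 * Real.sin (s / 2) ^ 2) : ℂ) *
          Complex.exp (-Complex.I * ((-(m : ℤ) : ℤ) : ℂ) * s) =
        (starRingEnd ℂ) ((Real.log (4 * Real.sin (s / 2) ^ 2) : ℂ) *
          Complex.exp (-Complex.I * s) ^ m) := by
      rw [map_mul, map_pow, Complex.conj_ofReal, ← Complex.exp_conj, ← Complex.exp_nat_mul]
      simp only [map_mul, map_neg, Complex.conj_I, Complex.conj_ofReal]
      push_cast
      ring_nf
    simp_rw [h]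
    rw [intervalIntegral.intervalIntegral_conj, integral_log_four_mul_sin_sq_mul_exp_pow hm]
    simp [Complex.conj_ofNat]
    field_simp
end

section
/- The complex exponentials are eigenfunctions of the periodized-log integral operator: for every integer n ≠ 0 and every x ∈ ℝ, ∫_0^{2π} (1/2) log|sin((x−s)/2)| e^{i n s} ds = −(π/(2|n|)) e^{i n x}. -/
open MeasureTheory intervalIntegral

lemma integral_exp_natCast_mul_I (k : ℕ) :
    ∫ t in (0:ℝ)..(2 * Real.pi), Complex.exp (Complex.I * t) ^ k
      = if k = 0 then 2 * (Real.pi : ℂ) else 0 := by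
  split_ifs with hk
  · simp [hk]
  · have hc : Complex.I * (k : ℂ) ≠ 0 := by simp [hk]
    have h := integral_exp_mul_complex (a := 0) (b := 2 * Real.pi) hc
    have h1 : Complex.exp (Complex.I * k * ((2 * Real.pi : ℝ) : ℂ)) = 1 := by
      rw [← Complex.exp_nat_mul_two_pi_mul_I k]
      push_cast
      ring_nf
    rw [h1] at h
    simp only [Complex.ofReal_zero, mul_zero, Complex.exp_zero, sub_self, zero_div] at h
    rw [← h]
    refine integral_congr fun t _ ↦ ?_
    simp only [← Complex.exp_nat_mul]
    ring_nf

/-- Only the constant term of the trigonometric polynomial `(w + 1) (1 + w + ⋯ + w ^ (m - 1))`,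
`w = exp (i t)`, contributes to its integral over a period. -/
lemma integral_exp_add_one_mul_geom_sum {m : ℕ} (hm : m ≠ 0) :
    ∫ t in (0:ℝ)..(2 * Real.pi), (Complex.exp (Complex.I * t) + 1) *
      ∑ k ∈ Finset.range m, Complex.exp (Complex.I * t) ^ k = 2 * (Real.pi : ℂ) := by
  have hpow (k : ℕ) : IntervalIntegrable (fun t : ℝ ↦ Complex.exp (Complex.I * t) ^ k)
      volume 0 (2 * Real.pi) := Continuous.intervalIntegrable (by fun_prop) _ _
  have h (t : ℝ) : (Complex.exp (Complex.I * t) + 1) *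
      ∑ k ∈ Finset.range m, Complex.exp (Complex.I * t) ^ k =
      ∑ k ∈ Finset.range m,
        (Complex.exp (Complex.I * t) ^ (k + 1) + Complex.exp (Complex.I * t) ^ k) := by
    rw [Finset.mul_sum]
    exact Finset.sum_congr rfl fun k _ ↦ by ring
  simp only [h]
  rw [integral_finsetSum fun k _ ↦ (hpow (k + 1)).add (hpow k)]
  simp only [integral_add (hpow _) (hpow _), integral_exp_natCast_mul_I]
  simp [hm, Nat.pos_iff_ne_zero]

lemma intervalIntegrable_log_sin_half (a b : ℝ) :
    IntervalIntegrable (fun t : ℝ ↦ Real.log (Real.sin (t / 2))) volume a b := by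
  have h := (intervalIntegrable_log_sin (a := a / 2) (b := b / 2)).comp_mul_left (c := 1 / 2)
  convert h using 2 <;> first | (simp only [Function.comp]; ring_nf) | ring

lemma exp_I_mul_sub_one (t : ℝ) :
    Complex.exp (Complex.I * t) - 1 =
      2 * Complex.I * Complex.exp (Complex.I * (t / 2 : ℝ)) * (Real.sin (t / 2) : ℂ) := by
  have h : Complex.exp (Complex.I * t) = Complex.exp (Complex.I * (t / 2 : ℝ)) ^ 2 := by
    rw [← Complex.exp_nat_mul]; push_cast; ring_nf
  rw [h, mul_comm Complex.I, Complex.exp_mul_I, ← Complex.ofReal_cos, ← Complex.ofReal_sin]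
  have hs : (Real.sin (t / 2) : ℂ) ^ 2 + (Real.cos (t / 2) : ℂ) ^ 2 = 1 := by
    exact_mod_cast Real.sin_sq_add_cos_sq (t / 2)
  linear_combination
    hs + (-(Real.sin (t / 2) : ℂ) ^ 2) * Complex.I_sq

lemma exp_I_mul_add_one (t : ℝ) :
    Complex.exp (Complex.I * t) + 1 =
      2 * Complex.exp (Complex.I * (t / 2 : ℝ)) * (Real.cos (t / 2) : ℂ) := by
  have h : Complex.exp (Complex.I * t) = Complex.exp (Complex.I * (t / 2 : ℝ)) ^ 2 := by
    rw [← Complex.exp_nat_mul]; push_cast; ring_nf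
  rw [h, mul_comm Complex.I, Complex.exp_mul_I, ← Complex.ofReal_cos, ← Complex.ofReal_sin]
  have hs : (Real.sin (t / 2) : ℂ) ^ 2 + (Real.cos (t / 2) : ℂ) ^ 2 = 1 := by
    exact_mod_cast Real.sin_sq_add_cos_sq (t / 2)
  linear_combination
    -hs + ((Real.sin (t / 2) : ℂ) ^ 2) * Complex.I_sq

lemma integral_log_sin_half_mul_exp_pow {m : ℕ} (hm : m ≠ 0) :
    ∫ t in (0:ℝ)..(2 * Real.pi),
      (Real.log (Real.sin (t / 2)) : ℂ) * Complex.exp (Complex.I * t) ^ m = -(Real.pi / m : ℂ) := by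
  have hmC : (m : ℂ) ≠ 0 := by exact_mod_cast hm
  let S (t : ℝ) : ℂ := ∑ k ∈ Finset.range m, Complex.exp (Complex.I * t) ^ k
  have hS : Continuous S := by unfold S; fun_prop
  have hgeom (t : ℝ) : Complex.exp (Complex.I * t) ^ m - 1 =
      S t * (2 * Complex.I * Complex.exp (Complex.I * (t / 2 : ℝ)) * (Real.sin (t / 2) : ℂ)) := by
    rw [← exp_I_mul_sub_one, geom_sum_mul]
  let u (t : ℝ) : ℂ := (Complex.exp (Complex.I * t) ^ m - 1) / (Complex.I * m) *
    (Real.log (Real.sin (t / 2)) : ℂ)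
  have hu : Continuous u := by
    have hu' : u = fun t ↦ S t * (2 * Complex.I * Complex.exp (Complex.I * (t / 2 : ℝ))) /
        (Complex.I * m) * ((Real.sin (t / 2) * Real.log (Real.sin (t / 2)) : ℝ) : ℂ) := by
      funext t
      simp only [u, hgeom]
      push_cast
      ring
    rw [hu']
    have := Real.continuous_mul_log.comp (f := fun t : ℝ ↦ Real.sin (t / 2)) (by fun_prop)
    simp only [Function.comp_def] at this
    fun_prop
  have hlog : IntervalIntegrable (fun t : ℝ ↦ (Real.log (Real.sin (t / 2)) : ℂ) *
      Complex.exp (Complex.I * t) ^ m) volume 0 (2 * Real.pi) :=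
    IntervalIntegrable.mul_continuousOn
      ⟨(intervalIntegrable_log_sin_half _ _).1.ofReal, (intervalIntegrable_log_sin_half _ _).2.ofReal⟩
      (Continuous.continuousOn (by fun_prop))
  have hrest : IntervalIntegrable (fun t : ℝ ↦ (1 / (2 * m) : ℂ) *
      ((Complex.exp (Complex.I * t) + 1) * S t)) volume 0 (2 * Real.pi) :=
    Continuous.intervalIntegrable (by fun_prop) _ _
  have hderiv (t : ℝ) (ht : t ∈ Set.Ioo 0 (2 * Real.pi)) : HasDerivAt u
      ((Real.log (Real.sin (t / 2)) : ℂ) * Complex.exp (Complex.I * t) ^ m +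
        (1 / (2 * m) : ℂ) * ((Complex.exp (Complex.I * t) + 1) * S t)) t := by
    have hsin : Real.sin (t / 2) ≠ 0 :=
      (Real.sin_pos_of_pos_of_lt_pi (by linarith [ht.1]) (by linarith [ht.2])).ne'
    have hsinC : (Real.sin (t / 2) : ℂ) ≠ 0 := by exact_mod_cast hsin
    have h1 : HasDerivAt (fun t : ℝ ↦ Real.log (Real.sin (t / 2)))
        (Real.cos (t / 2) * (1 / 2) / Real.sin (t / 2)) t :=
      (((hasDerivAt_id t).div_const 2).sin).log hsin
    have h2 : HasDerivAt (fun t : ℝ ↦ Complex.exp (Complex.I * t))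
        (Complex.exp (Complex.I * t) * (Complex.I * 1)) t :=
      ((hasDerivAt_id t).ofReal_comp.const_mul Complex.I).cexp
    refine HasDerivAt.congr_deriv (f := u)
      ((((h2.pow m).sub_const 1).div_const (Complex.I * m)).mul h1.ofReal_comp) ?_
    obtain ⟨k, rfl⟩ := Nat.exists_eq_succ_of_ne_zero hm
    simp only [Pi.pow_apply, hgeom, exp_I_mul_add_one]
    push_cast at hsinC hmC ⊢
    field_simp
    simp only [Nat.succ_eq_add_one]
    ring
  have hpi := Real.pi_pos
  have key := integral_eq_sub_of_hasDerivAt_of_le (by positivity) hu.continuousOn hderiv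
    (hlog.add hrest)
  rw [integral_add hlog hrest, intervalIntegral.integral_const_mul,
    integral_exp_add_one_mul_geom_sum hm] at key
  have h0 : u 0 = 0 := by simp [u]
  have h1 : u (2 * Real.pi) = 0 := by simp [u]
  rw [h0, h1, sub_zero] at key
  rw [eq_neg_of_add_eq_zero_left key]
  field_simp

lemma integral_log_sin_half_mul_exp {n : ℤ} (hn : n ≠ 0) :
    ∫ t in (0:ℝ)..(2 * Real.pi),
      (Real.log (Real.sin (t / 2)) : ℂ) * Complex.exp (Complex.I * n * t) =
      -((Real.pi / |(n : ℝ)| : ℝ) : ℂ) := by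
  obtain ⟨m, rfl | rfl⟩ := n.eq_nat_or_neg
  · have hm : m ≠ 0 := by exact_mod_cast hn
    convert integral_log_sin_half_mul_exp_pow hm using 1
    · refine integral_congr fun t _ ↦ ?_
      simp only [← Complex.exp_nat_mul]
      push_cast
      ring_nf
    · simp
  · have hm : m ≠ 0 := by simpa using hn
    rw [← sub_zero (2 * Real.pi), ← sub_self (2 * Real.pi), ← integral_comp_sub_left]
    convert integral_log_sin_half_mul_exp_pow hm using 1
    · simp only [sub_self]
      refine integral_congr fun t _ ↦ ?_
      have h1 : Real.sin ((2 * Real.pi - t) / 2) = Real.sin (t / 2) := by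
        rw [← Real.sin_pi_sub]
        ring_nf
      have h2 : Complex.exp (Complex.I * ((-(m : ℤ) : ℤ) : ℂ) * ((2 * Real.pi - t : ℝ) : ℂ)) =
          Complex.exp (Complex.I * t) ^ m := by
        rw [← Complex.exp_nat_mul, ← Complex.exp_periodic.int_mul m]
        push_cast
        ring_nf
      simp only [h1, h2]
    · simp

/-- The complex exponentials are eigenfunctions of the periodized-log integral operator:
for every integer `n ≠ 0` and every `x ∈ ℝ`,
`∫_0^{2π} (1/2) log|sin((x−s)/2)| e^{i n s} ds = −(π/(2|n|)) e^{i n x}`. -/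
theorem periodized_log_kernel_exp_eigenfunction (n : ℤ) (hn : n ≠ 0) (x : ℝ) :
    ∫ s in (0:ℝ)..(2 * Real.pi),
        (((1 / 2 : ℝ) * Real.log |Real.sin ((x - s) / 2)| : ℝ) : ℂ) *
          Complex.exp (Complex.I * (n : ℂ) * (s : ℂ))
      = -((Real.pi / (2 * |(n : ℝ)|) : ℝ) : ℂ) * Complex.exp (Complex.I * (n : ℂ) * (x : ℂ)) := by
  let g (t : ℝ) : ℂ := (Real.log (Real.sin (t / 2)) : ℂ) * Complex.exp (Complex.I * (-n : ℤ) * t)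
  have hg : Function.Periodic g (2 * Real.pi) := fun t ↦ by
    have h1 : Real.sin ((t + 2 * Real.pi) / 2) = -Real.sin (t / 2) := by
      rw [← Real.sin_add_pi]
      ring_nf
    have h2 : Complex.exp (Complex.I * (-n : ℤ) * ((t + 2 * Real.pi : ℝ) : ℂ)) =
        Complex.exp (Complex.I * (-n : ℤ) * t) := by
      rw [← Complex.exp_periodic.int_mul n]
      push_cast
      ring_nf
    simp only [g, h1, h2, Real.log_neg_eq_log]
  have hfun (s : ℝ) : (((1 / 2 : ℝ) * Real.log |Real.sin ((x - s) / 2)| : ℝ) : ℂ) *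
      Complex.exp (Complex.I * (n : ℂ) * (s : ℂ)) =
      (1 / 2 * Complex.exp (Complex.I * n * x)) * g (x - s) := by
    have h : Complex.exp (Complex.I * n * s) =
        Complex.exp (Complex.I * n * x) * Complex.exp (Complex.I * (-n : ℤ) * (x - s : ℝ)) := by
      rw [← Complex.exp_add]
      push_cast
      ring_nf
    simp only [g, h, Real.log_abs]
    push_cast
    ring
  simp only [hfun]
  rw [intervalIntegral.integral_const_mul, integral_comp_sub_left g x, sub_zero]
  have hper := hg.intervalIntegral_add_eq (x - 2 * Real.pi) 0
  rw [sub_add_cancel, zero_add] at hper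
  rw [hper, integral_log_sin_half_mul_exp (neg_ne_zero.mpr hn)]
  push_cast
  rw [abs_neg]
  ring
end

section
/- The eigenvalue −π log 2 of the periodized-log integral operator is simple: if f : ℝ → ℂ is continuous and 2π-periodic and satisfies (Kf)(x) = −π log 2 · f(x) for all x ∈ ℝ, then f is constant. -/
open MeasureTheory

theorem periodic_log_sin_half : Function.Periodic (fun u : ℝ => Real.log (Real.sin (u / 2)))
    (2 * Real.pi) := by
  intro u
  have h : (u + 2 * Real.pi) / 2 = u / 2 + Real.pi := by ring
  simp only [h, Real.sin_add_pi, Real.log_neg_eq_log]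

theorem intervalIntegrable_log_sin_sub_half (x a b : ℝ) :
    IntervalIntegrable (fun s : ℝ => Real.log (Real.sin ((x - s) / 2))) volume a b := by
  have h : IntervalIntegrable (fun u : ℝ => Real.log (Real.sin u)) volume
      ((x - a) / 2) ((x - b) / 2) := intervalIntegrable_log_sin
  have h2 := (h.comp_mul_left (c := 2⁻¹)).comp_sub_left x
  convert h2 using 1
  · ext s
    congr 2
    ring
  · field_simp
    ring
  · field_simp
    ring

theorem integral_log_sin_sub_half (x : ℝ) :
    ∫ s in (0 : ℝ)..(2 * Real.pi), Real.log (Real.sin ((x - s) / 2))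
      = -(2 * Real.pi * Real.log 2) := by
  rw [intervalIntegral.integral_comp_sub_left (fun u => Real.log (Real.sin (u / 2)))]
  have h := periodic_log_sin_half.intervalIntegral_add_eq (x - 2 * Real.pi) 0
  rw [sub_add_cancel, zero_add] at h
  rw [sub_zero, h, intervalIntegral.integral_comp_div (fun u => Real.log (Real.sin u)) two_ne_zero,
    zero_div, mul_div_cancel_left₀ _ two_ne_zero, integral_log_sin_zero_pi, smul_eq_mul]
  ring

theorem ae_log_sin_sub_half_ne_zero (x : ℝ) :
    ∀ᵐ s : ℝ, Real.log (Real.sin ((x - s) / 2)) ≠ 0 := by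
  have hc : (Set.range fun n : ℤ => x - n * Real.pi).Countable := Set.countable_range _
  filter_upwards [hc.ae_notMem volume] with s hs h0
  have hsin : Real.sin (x - s) = 0 := by
    rw [show x - s = 2 * ((x - s) / 2) by ring, Real.sin_two_mul]
    have hsq := Real.sin_sq_add_cos_sq ((x - s) / 2)
    rcases Real.log_eq_zero.mp h0 with h | h | h <;> rw [h] at hsq ⊢
    · simp
    · have : Real.cos ((x - s) / 2) = 0 := by nlinarith
      simp [this]
    · have : Real.cos ((x - s) / 2) = 0 := by nlinarith
      simp [this]
  obtain ⟨n, hn⟩ := Real.sin_eq_zero_iff.mp hsin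
  exact hs ⟨n, by simp only [hn]; ring⟩

/-- A maximum principle: as the kernel is nonpositive, at a maximum point of `g` the eigenvalue
equation forces `g` to be almost everywhere equal to its maximum. -/
theorem eq_const_of_integral_log_sin_mul_eq (g : ℝ → ℝ) (hg : Continuous g)
    (hper : Function.Periodic g (2 * Real.pi))
    (heig : ∀ x : ℝ, (∫ s in (0 : ℝ)..(2 * Real.pi), Real.log (Real.sin ((x - s) / 2)) * g s)
      = -(2 * Real.pi * Real.log 2) * g x) :
    ∃ c : ℝ, ∀ x : ℝ, g x = c := by
  have hpi : 0 < 2 * Real.pi := Real.two_pi_pos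
  obtain ⟨x₀, -, hx₀⟩ := isCompact_Icc.exists_isMaxOn
    (Set.nonempty_Icc.mpr hpi.le) hg.continuousOn
  have hmax : ∀ y, g y ≤ g x₀ := fun y => by
    obtain ⟨z, hz, hyz⟩ := hper.exists_mem_Ico₀ hpi y
    exact hyz ▸ hx₀ (Set.Ico_subset_Icc_self hz)
  have hk := intervalIntegrable_log_sin_sub_half x₀ 0 (2 * Real.pi)
  have hzero : ∫ s in (0 : ℝ)..(2 * Real.pi),
      -Real.log (Real.sin ((x₀ - s) / 2)) * (g x₀ - g s) = 0 := by
    have h : ∀ s, -Real.log (Real.sin ((x₀ - s) / 2)) * (g x₀ - g s)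
        = Real.log (Real.sin ((x₀ - s) / 2)) * g s
          - Real.log (Real.sin ((x₀ - s) / 2)) * g x₀ := fun s => by ring
    simp only [h]
    rw [intervalIntegral.integral_sub (hk.mul_continuousOn hg.continuousOn) (hk.mul_const _),
      intervalIntegral.integral_mul_const, integral_log_sin_sub_half, heig, sub_self]
  have hnonneg : ∀ s, 0 ≤ -Real.log (Real.sin ((x₀ - s) / 2)) * (g x₀ - g s) := fun s => by
    refine mul_nonneg (neg_nonneg.mpr ?_) (sub_nonneg.mpr (hmax s))
    rw [← Real.log_abs]
    exact Real.log_nonpos (abs_nonneg _) (Real.abs_sin_le_one _)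
  have hint : IntervalIntegrable (fun s => -Real.log (Real.sin ((x₀ - s) / 2)) * (g x₀ - g s))
      volume 0 (2 * Real.pi) :=
    hk.neg.mul_continuousOn (continuous_const.sub hg).continuousOn
  rw [intervalIntegral.integral_eq_zero_iff_of_le_of_nonneg_ae hpi.le
    (Filter.Eventually.of_forall hnonneg) hint] at hzero
  have hae : g =ᵐ[volume.restrict (Set.Ioc 0 (2 * Real.pi))] fun _ => g x₀ := by
    filter_upwards [hzero, ae_restrict_of_ae (ae_log_sin_sub_half_ne_zero x₀)] with s h0 hne
    rcases mul_eq_zero.mp h0 with h | h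
    · exact absurd (neg_eq_zero.mp h) hne
    · exact (sub_eq_zero.mp h).symm
  have heq := Measure.eqOn_Ioc_of_ae_eq volume hae hg.continuousOn continuousOn_const
  refine ⟨g x₀, fun x => ?_⟩
  obtain ⟨y, hy, hxy⟩ := hper.exists_mem_Ioc hpi x 0
  rw [zero_add] at hy
  exact hxy.trans (heq hy)

/-- The eigenvalue `−π log 2` of the periodized-log integral operator
`(Kf)(x) = ∫_0^{2π} (1/2) log|sin((x−s)/2)| f(s) ds` is simple: if `f : ℝ → ℂ` is continuous
and `2π`-periodic and satisfies `(Kf)(x) = −π log 2 · f(x)` for all `x`, then `f` is constant. -/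
theorem periodized_log_eigenvalue_neg_pi_log_two_simple
    (f : ℝ → ℂ) (hf : Continuous f) (hper : Function.Periodic f (2 * Real.pi))
    (heig : ∀ x : ℝ,
      (∫ s in (0:ℝ)..(2 * Real.pi),
          (((1 / 2 : ℝ) * Real.log |Real.sin ((x - s) / 2)| : ℝ) : ℂ) * f s)
        = ((-(Real.pi * Real.log 2) : ℝ) : ℂ) * f x) :
    ∃ c : ℂ, ∀ x : ℝ, f x = c := by
  have hproj : ∀ L : ℂ →L[ℝ] ℝ, ∃ c : ℝ, ∀ x : ℝ, L (f x) = c := fun L => by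
    refine eq_const_of_integral_log_sin_mul_eq (fun x => L (f x)) (L.continuous.comp hf)
      (fun x => congrArg L (hper x)) fun x => ?_
    have hint : IntervalIntegrable (fun s =>
        (((1 / 2 : ℝ) * Real.log |Real.sin ((x - s) / 2)| : ℝ) : ℂ) * f s)
        volume 0 (2 * Real.pi) := by
      have h := (intervalIntegrable_log_sin_sub_half x 0 (2 * Real.pi)).const_mul (1 / 2)
      simp only [Real.log_abs]
      exact IntervalIntegrable.mul_continuousOn ⟨h.1.ofReal, h.2.ofReal⟩ hf.continuousOn
    have h := L.intervalIntegral_comp_comm hint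
    rw [heig x] at h
    simp only [← Complex.real_smul, map_smul, smul_eq_mul, Real.log_abs, mul_assoc] at h
    rw [intervalIntegral.integral_const_mul] at h
    linarith
  obtain ⟨a, ha⟩ := hproj Complex.reCLM
  obtain ⟨b, hb⟩ := hproj Complex.imCLM
  exact ⟨⟨a, b⟩, fun x => Complex.ext (ha x) (hb x)⟩
end

section
/- The eigenspace of the periodized-log integral operator for the eigenvalue −π/(2n) is doubly degenerate, spanned by cos(nx) and sin(nx): if n ≥ 1 is an integer and f : ℝ → ℂ is continuous and 2π-periodic with (Kf)(x) = −(π/(2n)) f(x) for all x ∈ ℝ, then there exist complex constants a, b such that f(x) = a cos(nx) + b sin(nx) for all x. -/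
open Real MeasureTheory

theorem sin_two_mul_nat_mul (m : ℕ) (t : ℝ) :
    sin (2 * m * t) = sin t * ∑ k ∈ Finset.range m, 2 * cos ((2 * k + 1) * t) := by
  induction m with
  | zero => simp
  | succ m ih =>
    rw [Finset.sum_range_succ, mul_add, ← ih]
    have h₁ : 2 * ((m + 1 : ℕ) : ℝ) * t = (2 * m + 1) * t + t := by push_cast; ring
    have h₂ : 2 * (m : ℝ) * t = (2 * m + 1) * t - t := by ring
    rw [h₁, h₂, sin_add, sin_sub]
    ring

theorem integral_cos_mul_sum_cos {m : ℕ} (hm : m ≠ 0) :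
    ∫ t in 0..π, cos t * ∑ k ∈ Finset.range m, 2 * cos ((2 * k + 1) * t) = π := by
  have hcos (j : ℕ) : ∫ t in 0..π, cos (2 * j * t) = if j = 0 then π else 0 := by
    split_ifs with hj
    · simp [hj]
    · have h : (2 * j : ℝ) ≠ 0 := by positivity
      have hs : sin (2 * j * π) = 0 := by
        have := sin_nat_mul_pi (2 * j)
        push_cast at this
        exact this
      rw [intervalIntegral.integral_comp_mul_left (f := cos) h]
      simp [hs]
  have hprod (t : ℝ) (k : ℕ) : cos t * (2 * cos ((2 * k + 1) * t)) =
      cos (2 * (k + 1 : ℕ) * t) + cos (2 * k * t) := by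
    have h₁ : 2 * ((k + 1 : ℕ) : ℝ) * t = (2 * k + 1) * t + t := by push_cast; ring
    have h₂ : 2 * (k : ℝ) * t = (2 * k + 1) * t - t := by ring
    rw [h₁, h₂, cos_add, cos_sub]
    ring
  simp_rw [Finset.mul_sum, hprod]
  rw [intervalIntegral.integral_finsetSum
    fun k _ ↦ Continuous.intervalIntegrable (by fun_prop) _ _]
  have hterm (k : ℕ) : ∫ t in 0..π, (cos (2 * (k + 1 : ℕ) * t) + cos (2 * k * t)) =
      if k = 0 then π else 0 := by
    rw [intervalIntegral.integral_add (Continuous.intervalIntegrable (by fun_prop) _ _)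
      (Continuous.intervalIntegrable (by fun_prop) _ _), hcos, hcos]
    simp
  simp_rw [hterm]
  simp [hm]

theorem integral_log_sin_mul_cos {m : ℕ} (hm : m ≠ 0) :
    ∫ t in 0..π, log (sin t) * cos (2 * m * t) = -(π / (2 * m)) := by
  have hm' : (m : ℝ) ≠ 0 := by positivity
  set P : ℝ → ℝ := fun t ↦ ∑ k ∈ Finset.range m, 2 * cos ((2 * k + 1) * t) with hP
  have hPc : Continuous P := by fun_prop
  have hsin (t : ℝ) : sin (2 * m * t) = sin t * P t := sin_two_mul_nat_mul m t
  have hint₁ : IntervalIntegrable (fun t ↦ log (sin t) * cos (2 * m * t)) volume 0 π :=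
    intervalIntegrable_log_sin.mul_continuousOn (by fun_prop)
  have hint₂ : IntervalIntegrable (fun t ↦ cos t * P t) volume 0 π :=
    Continuous.intervalIntegrable (by fun_prop) _ _
  have hcont : Continuous fun t ↦ sin t * log (sin t) * P t :=
    (continuous_mul_log.comp continuous_sin).mul hPc
  have hFTC := intervalIntegral.integral_eq_sub_of_hasDerivAt_of_le pi_pos.le hcont.continuousOn
    (f' := fun t ↦ cos t * P t + 2 * m * (log (sin t) * cos (2 * m * t))) (fun t ht ↦ ?_)
    (hint₂.add (hint₁.const_mul _))
  · rw [intervalIntegral.integral_add hint₂ (hint₁.const_mul _),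
      intervalIntegral.integral_const_mul, integral_cos_mul_sum_cos hm] at hFTC
    simp only [sin_pi, sin_zero, zero_mul, sub_zero] at hFTC
    field_simp
    linarith
  · have hst : sin t ≠ 0 := (sin_pos_of_mem_Ioo ht).ne'
    have hd : HasDerivAt (fun t ↦ sin (2 * m * t)) (cos (2 * m * t) * (2 * m)) t := by
      simpa using ((hasDerivAt_id t).const_mul (2 * m : ℝ)).sin
    have h := ((hasDerivAt_sin t).log hst).mul hd
    convert! h using 1
    · ext u
      simp only [Pi.mul_apply, hsin]
      ring
    · rw [hsin]
      field_simp

/-- The convolution kernel `u ↦ log |sin (u / 2)| / 2`, seen as a complex-valued function. -/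
noncomputable def periodizedLog (u : ℝ) : ℂ := (((1 / 2 : ℝ) * log |sin (u / 2)| : ℝ) : ℂ)

theorem periodizedLog_periodic : Function.Periodic periodizedLog (2 * π) := fun u ↦ by
  have h : (u + 2 * π) / 2 = u / 2 + π := by ring
  simp only [periodizedLog, h, sin_add_pi, abs_neg]

theorem periodizedLog_neg (u : ℝ) : periodizedLog (-u) = periodizedLog u := by
  simp only [periodizedLog, neg_div, sin_neg, abs_neg]

theorem intervalIntegrable_periodizedLog (a b : ℝ) :
    IntervalIntegrable periodizedLog volume a b := by
  have h : AnalyticOnNhd ℝ (fun u : ℝ ↦ sin (u / 2)) (Set.uIcc a b) := fun u _ ↦ by fun_prop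
  have hlog := intervalIntegrable_iff.mp (h.meromorphicOn.intervalIntegrable_log.const_mul (1 / 2))
  rw [intervalIntegrable_iff]
  refine (hlog.ofReal (𝕜 := ℂ)).congr (ae_of_all _ fun u ↦ ?_)
  simp [periodizedLog]

theorem integral_periodizedLog_mul_cos (m : ℕ) :
    ∫ u in 0..2 * π, periodizedLog u * Complex.cos (m * u) =
      ((if m = 0 then -(log 2 * π) else -(π / (2 * m)) : ℝ) : ℂ) := by
  have hcongr (u : ℝ) : periodizedLog u * Complex.cos (m * u) =
      (((fun t ↦ 1 / 2 * (log (sin t) * cos (2 * m * t))) (u / 2) : ℝ) : ℂ) := by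
    have h : 2 * (m : ℂ) * (u / 2) = m * u := by ring
    simp only [periodizedLog, log_abs]
    push_cast
    rw [h]
    ring
  simp_rw [hcongr]
  rw [intervalIntegral.integral_ofReal, intervalIntegral.integral_comp_div
    (fun t ↦ 1 / 2 * (log (sin t) * cos (2 * m * t))) two_ne_zero,
    intervalIntegral.integral_const_mul, zero_div, mul_div_cancel_left₀ _ two_ne_zero]
  congr 1
  split_ifs with hm
  · simp [hm, integral_log_sin_zero_pi]
  · rw [integral_log_sin_mul_cos hm, smul_eq_mul]
    ring

theorem exp_int_mul_I_periodic (k : ℤ) :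
    Function.Periodic (fun x : ℝ ↦ Complex.exp (k * x * Complex.I)) (2 * π) := fun x ↦ by
  have h : (k : ℂ) * ((x + 2 * π : ℝ) : ℂ) * Complex.I =
      k * x * Complex.I + k * (2 * π * Complex.I) := by push_cast; ring
  simp only [h, Complex.exp_add, Complex.exp_int_mul_two_pi_mul_I, mul_one]

theorem integral_periodizedLog_mul_exp (k : ℤ) :
    ∫ u in 0..2 * π, periodizedLog u * Complex.exp (k * u * Complex.I) =
      ((if k.natAbs = 0 then -(log 2 * π) else -(π / (2 * k.natAbs)) : ℝ) : ℂ) := by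
  have hint (j : ℤ) : IntervalIntegrable
      (fun u : ℝ ↦ periodizedLog u * Complex.exp (j * u * Complex.I)) volume 0 (2 * π) :=
    (intervalIntegrable_periodizedLog _ _).mul_continuousOn (by fun_prop)
  have hper := periodizedLog_periodic.mul (exp_int_mul_I_periodic k)
  have hsymm : ∫ u in 0..2 * π, periodizedLog u * Complex.exp ((-k : ℤ) * u * Complex.I) =
      ∫ u in 0..2 * π, periodizedLog u * Complex.exp (k * u * Complex.I) := by
    have h := intervalIntegral.integral_comp_neg (a := 0) (b := 2 * π)
      (fun u : ℝ ↦ periodizedLog u * Complex.exp (k * u * Complex.I))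
    have h' := hper.intervalIntegral_add_eq (-(2 * π)) 0
    simp only [Pi.mul_apply, neg_add_cancel, zero_add] at h'
    rw [neg_zero, h'] at h
    rw [← h]
    refine intervalIntegral.integral_congr fun u _ ↦ ?_
    simp [periodizedLog_neg]
  have hcos (u : ℝ) : Complex.cos (k.natAbs * u) = Complex.cos (k * u) := by
    rcases Int.natAbs_eq k with h | h
    · rw [show (k : ℂ) = k.natAbs by rw [h]; simp]
    · rw [show (k : ℂ) = -k.natAbs by rw [h]; simp, neg_mul, Complex.cos_neg]
  rw [← integral_periodizedLog_mul_cos]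
  have hadd : ∫ u in 0..2 * π, 2 * (periodizedLog u * Complex.cos (k.natAbs * u)) =
      ∫ u in 0..2 * π, (periodizedLog u * Complex.exp (k * u * Complex.I) +
        periodizedLog u * Complex.exp ((-k : ℤ) * u * Complex.I)) := by
    refine intervalIntegral.integral_congr fun u _ ↦ ?_
    have h := Complex.two_cos (k * u)
    rw [← hcos] at h
    simp only [Int.cast_neg, neg_mul] at h ⊢
    rw [← mul_add, ← h]
    ring
  rw [intervalIntegral.integral_const_mul, intervalIntegral.integral_add (hint k) (hint (-k)),
    hsymm, ← two_mul] at hadd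
  exact (mul_left_cancel₀ two_ne_zero hadd).symm

theorem integral_convolution_mul_exp {g f : ℝ → ℂ} (hg : Function.Periodic g (2 * π))
    (hgi : IntervalIntegrable g volume 0 (2 * π)) (hf : Function.Periodic f (2 * π))
    (hfc : Continuous f) (k : ℤ) :
    ∫ x in 0..2 * π, (∫ s in 0..2 * π, g (x - s) * f s) * Complex.exp (k * x * Complex.I) =
      (∫ u in 0..2 * π, g u * Complex.exp (k * u * Complex.I)) *
        ∫ x in 0..2 * π, f x * Complex.exp (k * x * Complex.I) := by
  have hconv (x : ℝ) : ∫ s in 0..2 * π, g (x - s) * f s = ∫ u in 0..2 * π, g u * f (x - u) := by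
    have hper : Function.Periodic (fun u ↦ g u * f (x - u)) (2 * π) := fun u ↦ by
      have h : x - (u + 2 * π) + 2 * π = x - u := by ring
      simp only [hg u, ← hf (x - (u + 2 * π)), h]
    have h := intervalIntegral.integral_comp_sub_left (a := 0) (b := 2 * π)
      (fun u ↦ g u * f (x - u)) x
    have h' := hper.intervalIntegral_add_eq (x - 2 * π) 0
    simp only [sub_add_cancel, zero_add] at h'
    simpa only [sub_sub_cancel, sub_zero, h'] using h
  have hshift (u : ℝ) : ∫ x in 0..2 * π, f (x - u) * Complex.exp (k * x * Complex.I) =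
      Complex.exp (k * u * Complex.I) *
        ∫ x in 0..2 * π, f x * Complex.exp (k * x * Complex.I) := by
    have hper := hf.mul (exp_int_mul_I_periodic k)
    have h := hper.intervalIntegral_add_eq (0 - u) 0
    rw [zero_add, show 0 - u + 2 * π = 2 * π - u by ring,
      ← intervalIntegral.integral_comp_sub_right] at h
    simp only [Pi.mul_apply] at h
    rw [← h, ← intervalIntegral.integral_const_mul]
    refine intervalIntegral.integral_congr fun x _ ↦ ?_
    have he : (k : ℂ) * x * Complex.I =
        k * u * Complex.I + k * ((x - u : ℝ) : ℂ) * Complex.I := by push_cast; ring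
    simp only [he, Complex.exp_add]
    ring
  have hint : IntegrableOn (Function.uncurry fun x u ↦
      f (x - u) * Complex.exp (k * x * Complex.I) * g u)
      (Set.uIoc 0 (2 * π) ×ˢ Set.uIoc 0 (2 * π)) := by
    have hcont : Continuous fun p : ℝ × ℝ ↦
        f (p.1 - p.2) * Complex.exp (k * p.1 * Complex.I) := by fun_prop
    obtain ⟨C, hC⟩ := (isCompact_uIcc.prod isCompact_uIcc :
      IsCompact (Set.uIcc 0 (2 * π) ×ˢ Set.uIcc 0 (2 * π))).exists_bound_of_continuousOn
        hcont.continuousOn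
    have : IsFiniteMeasure (volume.restrict (Set.uIoc 0 (2 * π))) :=
      ⟨by simp [Set.uIoc]⟩
    rw [IntegrableOn, Measure.volume_eq_prod, ← Measure.prod_restrict]
    refine (Integrable.comp_snd hgi.def' _).bdd_mul (c := C) hcont.aestronglyMeasurable ?_
    rw [Measure.prod_restrict]
    filter_upwards [ae_restrict_mem (measurableSet_uIoc.prod measurableSet_uIoc)] with p hp
    exact hC p (Set.prod_mono Set.uIoc_subset_uIcc Set.uIoc_subset_uIcc hp)
  calc
    _ = ∫ x in 0..2 * π, ∫ u in 0..2 * π,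
        f (x - u) * Complex.exp (k * x * Complex.I) * g u := by
      simp_rw [hconv, ← intervalIntegral.integral_mul_const]
      congr! 4
      ring
    _ = ∫ u in 0..2 * π, ∫ x in 0..2 * π,
        f (x - u) * Complex.exp (k * x * Complex.I) * g u :=
      intervalIntegral_intervalIntegral_swap hint
    _ = _ := by
      simp_rw [intervalIntegral.integral_mul_const, hshift]
      rw [← intervalIntegral.integral_mul_const]
      congr! 2
      ring

theorem natAbs_eq_of_integral_periodizedLog_mul_exp {n : ℕ} {k : ℤ}
    (h : ∫ u in 0..2 * π, periodizedLog u * Complex.exp (k * u * Complex.I) =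
      ((-(π / (2 * n)) : ℝ) : ℂ)) (hn : 1 ≤ n) : k.natAbs = n := by
  rw [integral_periodizedLog_mul_exp, Complex.ofReal_inj] at h
  have hn' : (1 : ℝ) ≤ n := by exact_mod_cast hn
  have hπ := pi_pos
  split_ifs at h with hk
  · have hle : π / (2 * n) ≤ π / 2 := by gcongr; linarith
    nlinarith [log_two_gt_d9]
  · have hk' : (k.natAbs : ℝ) ≠ 0 := by exact_mod_cast hk
    field_simp at h
    exact_mod_cast (by linarith : (k.natAbs : ℝ) = n)

theorem eq_of_fourier_support {n : ℕ} (hn : 1 ≤ n) {f : ℝ → ℂ} (hf : Continuous f)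
    (hper : Function.Periodic f (2 * π))
    (hsupp : ∀ k : ℤ, k.natAbs ≠ n → ∫ x in 0..2 * π, f x * Complex.exp (k * x * Complex.I) = 0) :
    ∃ c d : ℂ, ∀ x : ℝ,
      f x = c * Complex.exp (n * x * Complex.I) + d * Complex.exp (-(n * x * Complex.I)) := by
  have : Fact (0 < 2 * π) := ⟨two_pi_pos⟩
  let F : C(AddCircle (2 * π), ℂ) := ⟨hper.lift, continuous_coinduced_dom.mpr hf⟩
  have hF (x : ℝ) : F x = f x := rfl
  have hfourier (k : ℤ) (x : ℝ) :
      fourier k (x : AddCircle (2 * π)) = Complex.exp (k * x * Complex.I) := by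
    rw [fourier_coe_apply]
    congr 1
    have : (π : ℂ) ≠ 0 := by exact_mod_cast pi_ne_zero
    push_cast
    field_simp
  have hzero (k : ℤ) (hk : k ∉ ({(n : ℤ), -(n : ℤ)} : Finset ℤ)) : fourierCoeff F k = 0 := by
    rw [fourierCoeff_eq_intervalIntegral _ _ 0, zero_add]
    have := hsupp (-k) (by simp at hk; lia)
    simp_rw [hfourier, hF, smul_eq_mul, mul_comm _ (f _)]
    rw [this, smul_zero]
  have hsum : Summable (fourierCoeff F) := summable_of_ne_finset_zero hzero
  refine ⟨fourierCoeff F n, fourierCoeff F (-n), fun x ↦ ?_⟩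
  have h := (has_pointwise_sum_fourier_series_of_summable hsum (x : AddCircle (2 * π))).unique
    (hasSum_sum_of_ne_finset_zero fun k hk ↦ by rw [hzero k hk, zero_smul])
  rw [hF, Finset.sum_pair (by lia), hfourier, hfourier] at h
  simpa using h

/-- The eigenspace of the periodized-log integral operator
`(Kf)(x) = ∫_0^{2π} (1/2) log|sin((x−s)/2)| f(s) ds` for the eigenvalue `−π/(2n)` is doubly
degenerate, spanned by `cos(nx)` and `sin(nx)`: if `n ≥ 1` and `f : ℝ → ℂ` is continuous and
`2π`-periodic with `(Kf)(x) = −(π/(2n)) f(x)` for all `x`, then `f(x) = a cos(nx) + b sin(nx)`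
for some complex constants `a, b`. -/
theorem periodized_log_eigenspace_doubly_degenerate
    (n : ℕ) (hn : 1 ≤ n)
    (f : ℝ → ℂ) (hf : Continuous f) (hper : Function.Periodic f (2 * Real.pi))
    (heig : ∀ x : ℝ,
      (∫ s in (0:ℝ)..(2 * Real.pi),
          (((1 / 2 : ℝ) * Real.log |Real.sin ((x - s) / 2)| : ℝ) : ℂ) * f s)
        = ((-(Real.pi / (2 * n)) : ℝ) : ℂ) * f x) :
    ∃ a b : ℂ, ∀ x : ℝ,
      f x = a * (Real.cos (n * x) : ℂ) + b * (Real.sin (n * x) : ℂ) := by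
  have heig' (x : ℝ) : ∫ s in 0..2 * π, periodizedLog (x - s) * f s =
      ((-(π / (2 * n)) : ℝ) : ℂ) * f x := heig x
  obtain ⟨c, d, h⟩ := eq_of_fourier_support hn hf hper fun k hk ↦ by
    by_contra hne
    have h := integral_convolution_mul_exp periodizedLog_periodic
      (intervalIntegrable_periodizedLog _ _) hper hf k
    simp_rw [heig', mul_assoc, intervalIntegral.integral_const_mul] at h
    refine hk (natAbs_eq_of_integral_periodizedLog_mul_exp (mul_right_cancel₀ hne ?_) hn)
    simp_rw [mul_assoc]
    exact h.symm
  refine ⟨c + d, (c - d) * Complex.I, fun x ↦ ?_⟩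
  rw [h, Complex.exp_mul_I, ← neg_mul, Complex.exp_mul_I, Complex.cos_neg, Complex.sin_neg]
  push_cast
  ring
end

section
/- Coercivity lower bound for the second-kind operator I + K: for every continuous 2π-periodic function f : ℝ → ℝ, ∫_0^{2π} |f(x) + (Kf)(x)|² dx ≥ (1 − π/4)² ∫_0^{2π} |f(x)|² dx. -/
open MeasureTheory Set Real

/-- The modified Dirichlet kernel `1 + 2 ∑_{0 < k < n} cos (k t) + cos (n t)`, for `0 < n`. -/
noncomputable def modifiedDirichlet (n : ℕ) (t : ℝ) : ℝ :=
  ∑ k ∈ Finset.range n, (cos (k * t) + cos ((k + 1 : ℕ) * t))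

lemma continuous_modifiedDirichlet (n : ℕ) : Continuous (modifiedDirichlet n) := by
  unfold modifiedDirichlet
  fun_prop

lemma cos_half_mul_sin_nat_mul (n : ℕ) (t : ℝ) :
    cos (t / 2) * sin (n * t) = sin (t / 2) * modifiedDirichlet n t := by
  induction n with
  | zero => simp [modifiedDirichlet]
  | succ n ih =>
    rw [modifiedDirichlet, Finset.sum_range_succ, mul_add, ← modifiedDirichlet, ← ih]
    have h₁ : (n : ℝ) * t = (n + 1 / 2) * t - t / 2 := by ring
    have h₂ : ((n + 1 : ℕ) : ℝ) * t = (n + 1 / 2) * t + t / 2 := by push_cast; ring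
    rw [h₁, h₂, sin_add, sin_sub, cos_add, cos_sub]
    ring

lemma sin_nat_mul_two_pi (n : ℕ) : sin (n * (2 * π)) = 0 := by
  simpa [mul_assoc] using sin_nat_mul_pi (n * 2)

lemma integral_cos_nat_mul_two_pi {n : ℕ} (hn : n ≠ 0) :
    ∫ t in (0 : ℝ)..2 * π, cos (n * t) = 0 := by
  have hn' : (n : ℝ) ≠ 0 := by exact_mod_cast hn
  rw [intervalIntegral.integral_comp_mul_left (fun t ↦ cos t) hn', integral_cos]
  simp [sin_nat_mul_two_pi]

lemma integral_modifiedDirichlet {n : ℕ} (hn : 1 ≤ n) :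
    ∫ t in (0 : ℝ)..2 * π, modifiedDirichlet n t = 2 * π := by
  have hint (k : ℕ) : IntervalIntegrable (fun t ↦ cos (k * t)) volume 0 (2 * π) :=
    Continuous.intervalIntegrable (by fun_prop) _ _
  unfold modifiedDirichlet
  rw [intervalIntegral.integral_finsetSum fun k _ ↦ (hint k).add (hint (k + 1))]
  simp_rw [intervalIntegral.integral_add (hint _) (hint _)]
  induction n, hn using Nat.le_induction with
  | base =>
    rw [Finset.sum_range_one, integral_cos_nat_mul_two_pi (Nat.succ_ne_zero 0)]
    simp
  | succ n hn ih =>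
    rw [Finset.sum_range_succ, ih, integral_cos_nat_mul_two_pi (by omega),
      integral_cos_nat_mul_two_pi (by omega)]
    ring

lemma intervalIntegrable_log_abs_sin_half (a b : ℝ) :
    IntervalIntegrable (fun t ↦ log |sin (t / 2)|) volume a b := by
  simp_rw [log_abs]
  have h := (intervalIntegrable_log_sin (a := a / 2) (b := b / 2)).comp_mul_right (c := 2⁻¹)
  simpa [div_eq_mul_inv] using h

lemma continuous_log_abs_sin_half_mul_sin (n : ℕ) :
    Continuous fun t ↦ log |sin (t / 2)| * sin (n * t) := by
  have h (t : ℝ) : log |sin (t / 2)| * sin (n * t) = sin (t / 2) * log (sin (t / 2)) *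
      ((Polynomial.Chebyshev.U ℝ (2 * n - 1)).eval (cos (t / 2))) := by
    have := Polynomial.Chebyshev.U_real_cos (t / 2) (2 * n - 1)
    push_cast at this
    rw [log_abs, show (n : ℝ) * t = (2 * n - 1 + 1) * (t / 2) by ring, ← this]
    ring
  simp_rw [h]
  exact (continuous_mul_log.comp (by fun_prop)).mul
    ((Polynomial.continuous _).comp (by fun_prop))

lemma integral_log_abs_sin_half :
    ∫ t in (0 : ℝ)..2 * π, log |sin (t / 2)| = -(2 * π * log 2) := by
  simp_rw [log_abs]
  rw [intervalIntegral.integral_comp_div (fun t ↦ log (sin t)) two_ne_zero]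
  simp [integral_log_sin_zero_pi]
  ring

lemma integral_log_abs_sin_half_mul_cos {n : ℕ} (hn : 1 ≤ n) :
    ∫ t in (0 : ℝ)..2 * π, log |sin (t / 2)| * cos (n * t) = -(π / n) := by
  have hn' : (n : ℝ) ≠ 0 := by positivity
  have hi₁ : IntervalIntegrable (fun t ↦ log |sin (t / 2)| * cos (n * t)) volume 0 (2 * π) :=
    (intervalIntegrable_log_abs_sin_half _ _).mul_continuousOn (by fun_prop)
  have hi₂ : IntervalIntegrable (fun t ↦ modifiedDirichlet n t / (2 * n)) volume 0 (2 * π) :=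
    ((continuous_modifiedDirichlet n).div_const _).intervalIntegrable _ _
  have key : ∫ t in (0 : ℝ)..2 * π,
      (log |sin (t / 2)| * cos (n * t) + modifiedDirichlet n t / (2 * n)) = 0 := by
    rw [intervalIntegral.integral_eq_sub_of_hasDerivAt_of_le two_pi_pos.le
      (f := fun t ↦ log |sin (t / 2)| * sin (n * t) / n)
      ((continuous_log_abs_sin_half_mul_sin n).div_const _).continuousOn _ (hi₁.add hi₂)]
    · simp [sin_nat_mul_two_pi]
    · intro t ht
      have hs : sin (t / 2) ≠ 0 :=
        (sin_pos_of_pos_of_lt_pi (by linarith [ht.1]) (by linarith [ht.2])).ne'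
      simp_rw [log_abs]
      have h₁ : HasDerivAt (fun t ↦ log (sin (t / 2))) (cos (t / 2) * (1 / 2) / sin (t / 2)) t :=
        (((hasDerivAt_id t).div_const 2).sin).log hs
      have h₂ : HasDerivAt (fun t ↦ sin (n * t)) (cos (n * t) * n) t := by
        simpa using! ((hasDerivAt_id t).const_mul (n : ℝ)).sin
      refine ((h₁.fun_mul h₂).div_const (n : ℝ)).congr_deriv ?_
      have h₃ := cos_half_mul_sin_nat_mul n t
      field_simp
      rw [mul_comm t]
      linear_combination h₃
  rw [intervalIntegral.integral_add hi₁ hi₂, intervalIntegral.integral_div,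
    integral_modifiedDirichlet hn] at key
  rw [eq_neg_of_add_eq_zero_left key]
  field_simp

lemma integral_log_abs_sin_half_mul_sin (n : ℤ) :
    ∫ t in (0 : ℝ)..2 * π, log |sin (t / 2)| * sin (n * t) = 0 := by
  have h := intervalIntegral.integral_comp_sub_left
    (fun t ↦ log |sin (t / 2)| * sin (n * t)) (2 * π) (a := 0) (b := 2 * π)
  have h' (t : ℝ) : log |sin ((2 * π - t) / 2)| * sin (n * (2 * π - t)) =
      -(log |sin (t / 2)| * sin (n * t)) := by
    rw [show (2 * π - t) / 2 = π - t / 2 by ring, sin_pi_sub,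
      show n * (2 * π - t) = n * (2 * π) - n * t by ring, sin_int_mul_two_pi_sub]
    ring
  simp only [h', intervalIntegral.integral_neg, sub_self, sub_zero] at h
  linarith

/-- The eigenvalue of the convolution with `(1/2) log |sin (t / 2)|` on `exp (i n x)`. -/
noncomputable def logSinEigenvalue (n : ℤ) : ℝ :=
  if n = 0 then -(π * log 2) else -(π / (2 * n.natAbs))

lemma integral_log_abs_sin_half_mul_exp (n : ℤ) :
    ∫ t in (0 : ℝ)..2 * π,
      (((1 / 2 : ℝ) * log |sin (t / 2)| : ℝ) : ℂ) * Complex.exp (-(n * t * Complex.I)) =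
      logSinEigenvalue n := by
  have hc (t : ℝ) :
      (((1 / 2 : ℝ) * log |sin (t / 2)| : ℝ) : ℂ) * Complex.exp (-(n * t * Complex.I)) =
      (1 / 2 : ℂ) * ((log |sin (t / 2)| * cos (n.natAbs * t) : ℝ) : ℂ) -
      (1 / 2 : ℂ) * Complex.I * ((log |sin (t / 2)| * sin (n * t) : ℝ) : ℂ) := by
    have hcos : cos (n.natAbs * t) = cos (n * t) := by
      rw [Nat.cast_natAbs, Int.cast_abs]
      rcases abs_choice (n : ℝ) with h | h <;> simp [h]
    rw [hcos, ← neg_mul, Complex.exp_mul_I]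
    push_cast
    simp only [Complex.cos_neg, Complex.sin_neg]
    ring
  have hi₁ : IntervalIntegrable (fun t ↦ log |sin (t / 2)| * cos (n.natAbs * t))
      volume 0 (2 * π) :=
    (intervalIntegrable_log_abs_sin_half _ _).mul_continuousOn (by fun_prop)
  have hi₂ : IntervalIntegrable (fun t ↦ log |sin (t / 2)| * sin (n * t)) volume 0 (2 * π) :=
    (intervalIntegrable_log_abs_sin_half _ _).mul_continuousOn (by fun_prop)
  simp_rw [hc]
  rw [intervalIntegral.integral_sub (IntervalIntegrable.const_mul ⟨hi₁.1.ofReal, hi₁.2.ofReal⟩ _)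
      (IntervalIntegrable.const_mul ⟨hi₂.1.ofReal, hi₂.2.ofReal⟩ _),
    intervalIntegral.integral_const_mul, intervalIntegral.integral_const_mul,
    intervalIntegral.integral_ofReal, intervalIntegral.integral_ofReal,
    integral_log_abs_sin_half_mul_sin]
  unfold logSinEigenvalue
  split_ifs with hn
  · simp only [hn, Int.natAbs_zero, Nat.cast_zero, zero_mul, cos_zero, mul_one,
      integral_log_abs_sin_half]
    push_cast
    ring
  · rw [integral_log_abs_sin_half_mul_cos (Int.natAbs_pos.2 hn)]
    push_cast
    field_simp
    ring

lemma one_sub_pi_div_four_le_abs_one_add_logSinEigenvalue (n : ℤ) :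
    1 - π / 4 ≤ |1 + logSinEigenvalue n| := by
  have hπ := pi_gt_three
  unfold logSinEigenvalue
  split_ifs with hn
  · have := log_two_gt_d9
    rw [abs_of_nonpos (by nlinarith)]
    nlinarith
  · obtain h | h : n.natAbs = 1 ∨ 2 ≤ n.natAbs := by omega
    · rw [h, abs_of_nonpos] <;> norm_num <;> linarith
    · refine le_trans ?_ (le_abs_self _)
      have h2 : (2 : ℝ) ≤ n.natAbs := by exact_mod_cast h
      have : π / (2 * n.natAbs) ≤ π / 4 := by gcongr; linarith
      linarith

section PeriodicConvolution

variable {k f : ℝ → ℝ} {T : ℝ}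

lemma Function.Periodic.intervalIntegral_convolution_comm
    (hk : Function.Periodic k T) (hf : Function.Periodic f T) (x : ℝ) :
    ∫ s in (0 : ℝ)..T, k (x - s) * f s = ∫ t in (0 : ℝ)..T, k t * f (x - t) := by
  have h := intervalIntegral.integral_comp_sub_left (fun t ↦ k t * f (x - t)) x (a := 0) (b := T)
  simp only [sub_sub_cancel, sub_zero] at h
  have hp : Function.Periodic (fun t ↦ k t * f (x - t)) T := fun t ↦ by
    simp only [hk t, ← sub_sub, hf.sub_eq]
  rw [h]
  simpa using hp.intervalIntegral_add_eq (x - T) 0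

lemma Function.Periodic.exists_forall_abs_le (hper : Function.Periodic f T) (hT : T ≠ 0)
    (hf : Continuous f) : ∃ C, ∀ x, |f x| ≤ C := by
  obtain ⟨C, hC⟩ := (hper.isBounded_of_continuous hT hf).exists_norm_le
  exact ⟨C, fun x ↦ hC _ ⟨x, rfl⟩⟩

lemma continuous_intervalIntegral_convolution (hk : IntervalIntegrable k volume 0 T)
    (hf : Continuous f) {C : ℝ} (hC : ∀ x, |f x| ≤ C) :
    Continuous fun x ↦ ∫ t in (0 : ℝ)..T, k t * f (x - t) := by
  refine intervalIntegral.continuous_of_dominated_interval (bound := fun t ↦ |k t| * C)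
    (fun x ↦ ?_) (fun x ↦ ?_) (hk.abs.mul_const C) ?_
  · exact hk.aestronglyMeasurable_restrict_uIoc.mul (by fun_prop)
  · refine Filter.Eventually.of_forall fun t _ ↦ ?_
    rw [norm_mul, norm_eq_abs, norm_eq_abs]
    gcongr
    exact hC _
  · exact Filter.Eventually.of_forall fun t _ ↦ by fun_prop

lemma intervalIntegral_convolution_mul_exp (hT : 0 < T) (hk : IntervalIntegrable k volume 0 T)
    (hf : Continuous f) (hper : Function.Periodic f T) {c : ℂ}
    (hc : Function.Periodic (fun x : ℝ ↦ Complex.exp (c * x)) T) :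
    ∫ x in (0 : ℝ)..T, Complex.exp (c * x) * ((∫ t in (0 : ℝ)..T, k t * f (x - t) : ℝ) : ℂ) =
      (∫ t in (0 : ℝ)..T, (k t : ℂ) * Complex.exp (c * t)) *
        ∫ x in (0 : ℝ)..T, Complex.exp (c * x) * (f x : ℂ) := by
  obtain ⟨C, hC⟩ := hper.exists_forall_abs_le hT.ne' hf
  have hexp : Continuous fun x : ℝ ↦ Complex.exp (c * x) := by fun_prop
  have hkC : IntegrableOn (fun t ↦ (k t : ℂ)) (uIoc 0 T) :=
    (intervalIntegrable_iff.1 hk).ofReal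
  have hint : IntegrableOn (Function.uncurry fun x t : ℝ ↦
      Complex.exp (c * x) * ((k t : ℂ) * (f (x - t) : ℂ))) (uIoc 0 T ×ˢ uIoc 0 T) := by
    have h₁ : IntegrableOn (fun x : ℝ ↦ Complex.exp (c * x)) (uIoc 0 T) :=
      intervalIntegrable_iff.1 (hexp.intervalIntegrable _ _)
    have h₂ := h₁.mul_prod hkC
    rw [Measure.prod_restrict, ← Measure.volume_eq_prod] at h₂
    have h₃ := h₂.mul_bdd (g := fun z : ℝ × ℝ ↦ (f (z.1 - z.2) : ℂ)) (c := C)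
      (by fun_prop) (Filter.Eventually.of_forall fun z ↦ by simpa using hC _)
    simpa only [IntegrableOn, Function.uncurry_def, mul_assoc] using h₃
  have hinner (t : ℝ) : ∫ x in (0 : ℝ)..T, Complex.exp (c * x) * ((k t : ℂ) * (f (x - t) : ℂ)) =
      (k t : ℂ) * Complex.exp (c * t) * ∫ x in (0 : ℝ)..T, Complex.exp (c * x) * (f x : ℂ) := by
    have hp : Function.Periodic (fun x : ℝ ↦ Complex.exp (c * x) * (f x : ℂ)) T := fun x ↦ by
      simp only [hc x, hper x]
    have h := intervalIntegral.integral_comp_sub_right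
      (fun x : ℝ ↦ Complex.exp (c * x) * (f x : ℂ)) t (a := 0) (b := T)
    rw [show T - t = (0 - t) + T by ring, hp.intervalIntegral_add_eq _ 0, zero_add] at h
    rw [← h, ← intervalIntegral.integral_const_mul]
    congr 1 with x
    rw [show c * (x : ℂ) = c * t + c * ((x - t : ℝ) : ℂ) by push_cast; ring, Complex.exp_add]
    ring
  calc
    _ = ∫ x in (0 : ℝ)..T, ∫ t in (0 : ℝ)..T,
        Complex.exp (c * x) * ((k t : ℂ) * (f (x - t) : ℂ)) := by
      simp_rw [intervalIntegral.integral_const_mul, ← intervalIntegral.integral_ofReal,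
        Complex.ofReal_mul]
    _ = _ := by
      rw [intervalIntegral_intervalIntegral_swap hint]
      simp_rw [hinner]
      rw [intervalIntegral.integral_mul_const]

end PeriodicConvolution

lemma fourierCoeffOn_two_pi_eq (g : ℝ → ℂ) (n : ℤ) :
    fourierCoeffOn two_pi_pos g n =
      (1 / (2 * π)) • ∫ x in (0 : ℝ)..2 * π, Complex.exp (-(n * Complex.I) * x) * g x := by
  rw [fourierCoeffOn_eq_integral, sub_zero]
  congr 2 with x
  rw [fourier_coe_apply, smul_eq_mul]
  congr 2
  have : (π : ℂ) ≠ 0 := by exact_mod_cast pi_ne_zero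
  push_cast
  field_simp

lemma periodic_exp_neg_int_mul_I (n : ℤ) :
    Function.Periodic (fun x : ℝ ↦ Complex.exp (-(n * Complex.I) * x)) (2 * π) := fun x ↦ by
  have h : -(n * Complex.I) * ((x + 2 * π : ℝ) : ℂ) =
      -(n * Complex.I) * x + (-n : ℤ) * (2 * π * Complex.I) := by
    push_cast
    ring
  simp only [h, Complex.exp_add, Complex.exp_int_mul_two_pi_mul_I, mul_one]

lemma periodic_half_log_abs_sin_half :
    Function.Periodic (fun t ↦ (1 / 2 : ℝ) * log |sin (t / 2)|) (2 * π) := fun t ↦ by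
  simp only [show (t + 2 * π) / 2 = t / 2 + π by ring, sin_add_pi, abs_neg]

lemma Continuous.hasSum_sq_fourierCoeffOn {g : ℝ → ℝ} (hg : Continuous g) :
    HasSum (fun n ↦ ‖fourierCoeffOn two_pi_pos (fun x ↦ (g x : ℂ)) n‖ ^ 2)
      ((2 * π)⁻¹ * ∫ x in (0 : ℝ)..2 * π, |g x| ^ 2) := by
  have hL2 : MemLp (fun x ↦ (g x : ℂ)) 2 (volume.restrict (Ioc 0 (2 * π))) := by
    have hgc : Continuous fun x ↦ (g x : ℂ) := by fun_prop
    rw [memLp_two_iff_integrable_sq_norm hgc.aestronglyMeasurable]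
    exact ((hgc.norm.pow 2).integrableOn_Icc).mono_set Ioc_subset_Icc_self
  simpa using _root_.hasSum_sq_fourierCoeffOn two_pi_pos hL2

/-- Coercivity lower bound for the second-kind operator `I + K`, where
`(Kf)(x) = ∫_0^{2π} (1/2) log|sin((x−s)/2)| f(s) ds`: for every continuous `2π`-periodic
real function `f`, `∫_0^{2π} |f(x) + (Kf)(x)|² dx ≥ (1 − π/4)² ∫_0^{2π} |f(x)|² dx`. -/
theorem second_kind_operator_coercivity
    (f : ℝ → ℝ) (hf : Continuous f) (hper : Function.Periodic f (2 * Real.pi)) :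
    (∫ x in (0:ℝ)..(2 * Real.pi),
        |f x + ∫ s in (0:ℝ)..(2 * Real.pi),
            (1 / 2 : ℝ) * Real.log |Real.sin ((x - s) / 2)| * f s| ^ 2)
      ≥ (1 - Real.pi / 4) ^ 2 * ∫ x in (0:ℝ)..(2 * Real.pi), |f x| ^ 2 := by
  have hk : IntervalIntegrable (fun t ↦ (1 / 2 : ℝ) * log |sin (t / 2)|) volume 0 (2 * π) :=
    (intervalIntegrable_log_abs_sin_half _ _).const_mul _
  obtain ⟨C, hC⟩ := hper.exists_forall_abs_le two_pi_pos.ne' hf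
  have hconv := periodic_half_log_abs_sin_half.intervalIntegral_convolution_comm hper
  simp_rw [hconv]
  set g : ℝ → ℝ := fun x ↦ ∫ t in (0 : ℝ)..2 * π, (1 / 2 : ℝ) * log |sin (t / 2)| * f (x - t)
  have hg : Continuous g := continuous_intervalIntegral_convolution hk hf hC
  have hcoeff (n : ℤ) : fourierCoeffOn two_pi_pos (fun x ↦ ((f x + g x : ℝ) : ℂ)) n =
      ((1 + logSinEigenvalue n : ℝ) : ℂ) * fourierCoeffOn two_pi_pos (fun x ↦ (f x : ℂ)) n := by
    have h₁ := intervalIntegral_convolution_mul_exp two_pi_pos hk hf hper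
      (periodic_exp_neg_int_mul_I n)
    have h₂ := integral_log_abs_sin_half_mul_exp n
    simp_rw [show ∀ t : ℝ, -((n : ℂ) * t * Complex.I) = -(n * Complex.I) * t from
      fun t ↦ by ring] at h₂
    rw [h₂] at h₁
    rw [fourierCoeffOn_two_pi_eq, fourierCoeffOn_two_pi_eq, mul_smul_comm]
    congr 1
    simp_rw [Complex.ofReal_add, mul_add]
    rw [intervalIntegral.integral_add (Continuous.intervalIntegrable (by fun_prop) _ _)
      (Continuous.intervalIntegrable (by fun_prop) _ _), h₁]
    push_cast
    ring
  have hle := hasSum_le (fun n ↦ ?_) ((hf.hasSum_sq_fourierCoeffOn).mul_left ((1 - π / 4) ^ 2))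
    ((hf.fun_add hg).hasSum_sq_fourierCoeffOn)
  · rw [mul_left_comm] at hle
    exact le_of_mul_le_mul_left hle (by positivity)
  · rw [hcoeff, norm_mul, mul_pow, Complex.norm_real, norm_eq_abs]
    have : 0 ≤ 1 - π / 4 := by linarith [pi_lt_four]
    gcongr
    exact one_sub_pi_div_four_le_abs_one_add_logSinEigenvalue n
end
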